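/- arXiv:1804.04687 — 2 statements merged into one kernel-verified Lean document; each statement's English description precedes it below -/
import Mathlib

section
/- Let J be a real d×N matrix, Γ a real n×N matrix, and η > 0. Define ΔD = J Γᵀ (η I_n + Γ Γᵀ)⁻¹ (an d×n matrix). Then ‖J − ΔD Γ‖_F² ≤ ‖J‖_F², i.e., the residue is non-increasing after the dictionary update step. -/
open Matrix

/-- The Frobenius norm of a real matrix: `‖X‖_F = sqrt (∑ i j, X i j ^ 2)`. -/
noncomputable def frobeniusNorm {m n : ℕ} (X : Matrix (Fin m) (Fin n) ℝ) : ℝ :=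
  Real.sqrt (∑ i, ∑ j, (X i j) ^ 2)

theorem frobeniusNorm_sq_eq_trace {m n : ℕ} (X : Matrix (Fin m) (Fin n) ℝ) :
    frobeniusNorm X ^ 2 = (X * Xᵀ).trace := by
  rw [frobeniusNorm, Real.sq_sqrt (by positivity)]
  simp [Matrix.trace, Matrix.mul_apply, sq]

theorem isUnit_det_smul_one_add_mul_transpose {N n : ℕ} (Γ : Matrix (Fin n) (Fin N) ℝ)
    {η : ℝ} (hη : 0 < η) :
    IsUnit (η • (1 : Matrix (Fin n) (Fin n) ℝ) + Γ * Γᵀ).det := by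
  have h : (Γ * Γᵀ).PosSemidef := by
    simpa [conjTranspose_eq_transpose_of_trivial] using posSemidef_self_mul_conjTranspose Γ
  exact ((PosDef.one.smul hη).add_posSemidef h).det_pos.ne'.isUnit

/-- If `D` solves the normal equation `D (η I + Γ Γᵀ) = J Γᵀ` with `0 ≤ η`, then subtracting `D Γ`
from `J` does not increase the Frobenius norm. -/
theorem frobeniusNorm_sq_sub_mul_le {d N n : ℕ} {J : Matrix (Fin d) (Fin N) ℝ}
    {Γ : Matrix (Fin n) (Fin N) ℝ} {D : Matrix (Fin d) (Fin n) ℝ} {η : ℝ} (hη : 0 ≤ η)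
    (hD : D * (η • (1 : Matrix (Fin n) (Fin n) ℝ) + Γ * Γᵀ) = J * Γᵀ) :
    frobeniusNorm (J - D * Γ) ^ 2 ≤ frobeniusNorm J ^ 2 := by
  obtain ⟨R, rfl⟩ : ∃ R, J = R + D * Γ := ⟨J - D * Γ, by simp⟩
  have hR : R * Γᵀ = η • D := by
    rw [Matrix.mul_add, Matrix.add_mul, Matrix.mul_assoc D Γ] at hD
    simpa using (add_right_cancel hD).symm
  have hcross : (R * (D * Γ)ᵀ).trace = η * frobeniusNorm D ^ 2 := by
    rw [transpose_mul, ← Matrix.mul_assoc, hR, smul_mul, trace_smul, smul_eq_mul,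
      frobeniusNorm_sq_eq_trace]
  have hcross' : (D * Γ * Rᵀ).trace = η * frobeniusNorm D ^ 2 := by
    rw [← hcross, ← trace_transpose, transpose_mul, transpose_transpose]
  have hexpand : frobeniusNorm (R + D * Γ) ^ 2 =
      frobeniusNorm R ^ 2 + 2 * (η * frobeniusNorm D ^ 2) + frobeniusNorm (D * Γ) ^ 2 := by
    simp only [frobeniusNorm_sq_eq_trace (R + D * Γ), frobeniusNorm_sq_eq_trace R,
      frobeniusNorm_sq_eq_trace (D * Γ), transpose_add, Matrix.add_mul, Matrix.mul_add,
      trace_add, hcross, hcross']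
    ring
  rw [add_sub_cancel_right, hexpand]
  have : 0 ≤ η * frobeniusNorm D ^ 2 := by positivity
  have := sq_nonneg (frobeniusNorm (D * Γ))
  linarith

/-- Proposition 1: the residue is non-increasing after the dictionary update step
`ΔD = J Γᵀ (η I_n + Γ Γᵀ)⁻¹`, i.e. `‖J − ΔD Γ‖_F² ≤ ‖J‖_F²`. -/
theorem residue_nonincreasing {d N n : ℕ}
    (J : Matrix (Fin d) (Fin N) ℝ) (Γ : Matrix (Fin n) (Fin N) ℝ)
    (η : ℝ) (hη : 0 < η) :
    frobeniusNorm (J - (J * Γᵀ * (η • (1 : Matrix (Fin n) (Fin n) ℝ) + Γ * Γᵀ)⁻¹) * Γ) ^ 2 ≤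
      frobeniusNorm J ^ 2 :=
  frobeniusNorm_sq_sub_mul_le hη.le
    (nonsing_inv_mul_cancel_right _ _ (isUnit_det_smul_one_add_mul_transpose Γ hη))
end

section
/- Let Γ be a real n×N matrix and η > 0, and set M = Γᵀ (η I_n + Γ Γᵀ)⁻¹ Γ. Then the N×N matrix 2M − M² is positive semidefinite. -/
open Matrix

/-- For `η > 0` the regularized Gram matrix `η I + Γ Γᵀ` is positive definite. -/
lemma posDef_smul_one_add_mul_transpose {m n : Type*} [Fintype m] [DecidableEq m] [Fintype n]
    (Γ : Matrix m n ℝ) {η : ℝ} (hη : 0 < η) :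
    (η • (1 : Matrix m m ℝ) + Γ * Γᵀ).PosDef := by
  have h := posSemidef_self_mul_conjTranspose Γ
  rw [conjTranspose_eq_transpose_of_trivial] at h
  exact (PosDef.one.smul hη).add_posSemidef h


/-- For a real `n × N` matrix `Γ`, `η > 0`, and `M = Γᵀ (η I_n + Γ Γᵀ)⁻¹ Γ`, the matrix
`2M − M²` is positive semidefinite. -/
theorem two_M_sub_M_sq_posSemidef {n N : ℕ}
    (Γ : Matrix (Fin n) (Fin N) ℝ) (η : ℝ) (hη : 0 < η) :
    letI M : Matrix (Fin N) (Fin N) ℝ :=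
      Γᵀ * (η • (1 : Matrix (Fin n) (Fin n) ℝ) + Γ * Γᵀ)⁻¹ * Γ
    ((2 : ℝ) • M - M * M).PosSemidef := by
  have hA := posDef_smul_one_add_mul_transpose Γ hη
  set A := η • (1 : Matrix (Fin n) (Fin n) ℝ) + Γ * Γᵀ with hAdef
  have hdet : IsUnit A.det := (isUnit_iff_isUnit_det A).mp hA.isUnit
  have hS : (A + η • (1 : Matrix (Fin n) (Fin n) ℝ)).PosSemidef :=
    (hA.add (PosDef.one.smul hη)).posSemidef
  have hSeq : A + η • (1 : Matrix (Fin n) (Fin n) ℝ) = (2 : ℝ) • A - Γ * Γᵀ := by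
    rw [hAdef]
    module
  have hB : (A⁻¹ * Γ)ᴴ = Γᵀ * A⁻¹ := by
    rw [conjTranspose_mul, hA.inv.isHermitian.eq, conjTranspose_eq_transpose_of_trivial]
  have hmid : A⁻¹ * (A + η • (1 : Matrix (Fin n) (Fin n) ℝ)) * A⁻¹ =
      (2 : ℝ) • A⁻¹ - A⁻¹ * (Γ * Γᵀ) * A⁻¹ := by
    rw [hSeq, Matrix.mul_sub, Matrix.sub_mul, Matrix.mul_smul, Matrix.smul_mul,
      nonsing_inv_mul A hdet, Matrix.one_mul]
  have h := hS.conjTranspose_mul_mul_same (A⁻¹ * Γ)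
  have heq : (2 : ℝ) • (Γᵀ * A⁻¹ * Γ) - Γᵀ * A⁻¹ * Γ * (Γᵀ * A⁻¹ * Γ) =
      (A⁻¹ * Γ)ᴴ * (A + η • (1 : Matrix (Fin n) (Fin n) ℝ)) * (A⁻¹ * Γ) :=
    calc
      _ = Γᵀ * ((2 : ℝ) • A⁻¹ - A⁻¹ * (Γ * Γᵀ) * A⁻¹) * Γ := by
        simp only [Matrix.mul_sub, Matrix.sub_mul, Matrix.mul_smul, Matrix.smul_mul,
          Matrix.mul_assoc]
      _ = _ := by
        rw [← hmid, hB]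
        simp only [Matrix.mul_assoc]
  exact heq ▸ h
end
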